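/- Let V be a 6-dimensional real vector space with fixed basis v₁,…,v₆ and dual basis v¹,…,v⁶, and let V_e, V_f, V_g, V_h be four copies of V with corresponding bases e_i, f_i, g_i, h_i. For any τ ∈ Λ³V*, denote by τ_e, τ_f, τ_g, τ_h the corresponding 3-forms on the copies, viewed inside Λ((V_e ⊕ V_f ⊕ V_g ⊕ V_h)*). Then τ_e ∧ C_{gfe} ∧ τ_f ∧ τ_h ∧ C_{fgh} ∧ τ_g = −6·λ(τ)·vol_{efgh}, where vol_{efgh} = vol_e ∧ vol_f ∧ vol_g ∧ vol_h with vol = v¹∧…∧v⁶, and λ(τ) is the scalar obtained from the Hitchin invariant via the identification (Λ⁶V*)^⊗2 ≅ ℝ given by vol⊗vol ↦ 1. -/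

import Mathlib

set_option synthInstance.maxHeartbeats 1000000
set_option maxHeartbeats 1000000

open ExteriorAlgebra Module

noncomputable section

/-- The degree-`k` homogeneous component of the exterior algebra of `V`. -/
def degPart (V : Type*) [AddCommGroup V] [Module ℝ V] (k : ℕ) :
    Submodule ℝ (ExteriorAlgebra ℝ V) :=
  LinearMap.range (ExteriorAlgebra.ι ℝ : V →ₗ[ℝ] ExteriorAlgebra ℝ V) ^ k

/-- `c` is the interior product (contraction) with the vector `X : V` on `Λ V*`. -/
def IsContraction {V : Type*} [AddCommGroup V] [Module ℝ V] (X : V)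
    (c : ExteriorAlgebra ℝ (Dual ℝ V) →ₗ[ℝ] ExteriorAlgebra ℝ (Dual ℝ V)) : Prop :=
  (∀ k, ∀ x ∈ degPart (Dual ℝ V) k, ∀ y,
      c (x * y) = c x * y + ((-1 : ℝ)) ^ k • (x * c y)) ∧
  (∀ α : Dual ℝ V, c (ExteriorAlgebra.ι ℝ α) = algebraMap ℝ _ (α X))

variable {V : Type*} [AddCommGroup V] [Module ℝ V]

/-- The 1-form `x^j` on the direct sum of `m` copies of `V`: the pullback of the `j`-th dual
basis vector under the projection onto the `x`-th copy. -/
def copyForm (m : ℕ) (b : Basis (Fin 6) ℝ V) (x : Fin m) (j : Fin 6) :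
    ExteriorAlgebra ℝ (Dual ℝ (Fin m → V)) :=
  ExteriorAlgebra.ι ℝ ((LinearMap.proj x : (Fin m → V) →ₗ[ℝ] V).dualMap (b.dualBasis j))

/-- The image `τ_x` of a form `τ ∈ Λ V*` in the `x`-th copy inside `Λ ((V_0 ⊕ ⋯ ⊕ V_{m-1})*)`. -/
def copyMap (m : ℕ) (x : Fin m) :
    ExteriorAlgebra ℝ (Dual ℝ V) →ₐ[ℝ] ExteriorAlgebra ℝ (Dual ℝ (Fin m → V)) :=
  ExteriorAlgebra.map (LinearMap.proj x : (Fin m → V) →ₗ[ℝ] V).dualMap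

/-- The element `C_{xyz} = Σ_σ (-1)^σ x^i ∧ y^j ∧ y^k ∧ z^r ∧ z^s ∧ z^t`, the sum running over
all (1,2,3)-shuffles `σ = {{i},{j,k},{r,s,t}}` of `{1,…,6}`.  Since each shuffle corresponds to
exactly `2!·3! = 12` permutations of `Fin 6`, all contributing equally, it can be written as
`(1/12) Σ_{σ ∈ S₆} sgn(σ) x^{σ(1)} ∧ y^{σ(2)} ∧ y^{σ(3)} ∧ z^{σ(4)} ∧ z^{σ(5)} ∧ z^{σ(6)}`. -/
def shuffleForm (m : ℕ) (b : Basis (Fin 6) ℝ V) (x y z : Fin m) :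
    ExteriorAlgebra ℝ (Dual ℝ (Fin m → V)) :=
  (12⁻¹ : ℝ) • ∑ σ : Equiv.Perm (Fin 6), ((Equiv.Perm.sign σ : ℤ) : ℝ) •
    (copyForm m b x (σ 0) * copyForm m b y (σ 1) * copyForm m b y (σ 2) *
     copyForm m b z (σ 3) * copyForm m b z (σ 4) * copyForm m b z (σ 5))

/-- The volume form `x¹ ∧ ⋯ ∧ x⁶` of the `x`-th copy. -/
def copyVol (m : ℕ) (b : Basis (Fin 6) ℝ V) (x : Fin m) :
    ExteriorAlgebra ℝ (Dual ℝ (Fin m → V)) :=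
  (List.ofFn fun j : Fin 6 => copyForm m b x j).prod

/-- The volume form `v¹ ∧ ⋯ ∧ v⁶ ∈ Λ⁶ V*`. -/
def volForm (b : Basis (Fin 6) ℝ V) : ExteriorAlgebra ℝ (Dual ℝ V) :=
  (List.ofFn fun j : Fin 6 => ExteriorAlgebra.ι ℝ (b.dualBasis j)).prod

section PolarizedVolume

variable {N : Type*} [AddCommGroup N] [Module ℝ N]

theorem mul_comm_of_mem_degPart {k l : ℕ} {x y : ExteriorAlgebra ℝ N}
    (hx : x ∈ degPart N k) (hy : y ∈ degPart N l) : y * x = (-1 : ℝ) ^ (k * l) • (x * y) := by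
  have one (a : N) {l : ℕ} {y : ExteriorAlgebra ℝ N} (hy : y ∈ degPart N l) :
      y * ι ℝ a = (-1 : ℝ) ^ l • (ι ℝ a * y) := by
    induction hy using Submodule.pow_induction_on_left' with
    | algebraMap r => simp [Algebra.commutes]
    | add x y i hx hy h₁ h₂ => rw [add_mul, h₁, h₂, mul_add, smul_add]
    | mem_mul m hm i x hx h =>
      obtain ⟨b, rfl⟩ := hm
      rw [mul_assoc, h, mul_smul_comm, ← mul_assoc, ← mul_assoc,
        eq_neg_of_add_eq_zero_left (ι_add_mul_swap b a), pow_succ]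
      simp
  induction hx using Submodule.pow_induction_on_left' with
  | algebraMap r => simp [Algebra.commutes]
  | add x x' i hx hx' h₁ h₂ => rw [mul_add, h₁, h₂, add_mul, smul_add]
  | mem_mul m hm i x hx h =>
    obtain ⟨b, rfl⟩ := hm
    rw [← mul_assoc, one b hy, smul_mul_assoc, mul_assoc, h, mul_smul_comm, smul_smul, mul_assoc,
      ← pow_add, Nat.succ_mul, add_comm]

theorem ιMulti_mem_degPart {k : ℕ} (v : Fin k → N) : ιMulti ℝ k v ∈ degPart N k :=
  ιMulti_range ℝ k ⟨v, rfl⟩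

theorem span_range_ιMulti (k : ℕ) :
    Submodule.span ℝ (Set.range (ιMulti ℝ k)) = degPart N k :=
  ιMulti_span_fixedDegree ℝ k

theorem ι_mem_degPart (v : N) : ι ℝ v ∈ degPart N 1 := by
  rw [degPart, pow_one]
  exact ⟨v, rfl⟩

theorem mul_mem_degPart {k l : ℕ} {x y : ExteriorAlgebra ℝ N}
    (hx : x ∈ degPart N k) (hy : y ∈ degPart N l) : x * y ∈ degPart N (k + l) := by
  rw [degPart, pow_add]
  exact Submodule.mul_mem_mul hx hy

theorem map_mem_degPart {M : Type*} [AddCommGroup M] [Module ℝ M] (f : N →ₗ[ℝ] M) {k : ℕ}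
    {x : ExteriorAlgebra ℝ N} (hx : x ∈ degPart N k) : ExteriorAlgebra.map f x ∈ degPart M k := by
  rw [← span_range_ιMulti] at hx
  induction hx using Submodule.span_induction with
  | mem x h =>
    obtain ⟨v, rfl⟩ := h
    rw [map_apply_ιMulti]
    exact ιMulti_mem_degPart _
  | zero => simp
  | add x y _ _ h₁ h₂ => rw [map_add]; exact add_mem h₁ h₂
  | smul a x _ h => rw [map_smul]; exact Submodule.smul_mem _ _ h

/-- Interior product with `X` on `Λ V*`, as a special case of Clifford contraction. -/
def contraction : V →ₗ[ℝ] ExteriorAlgebra ℝ (Dual ℝ V) →ₗ[ℝ] ExteriorAlgebra ℝ (Dual ℝ V) :=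
  CliffordAlgebra.contractLeft ∘ₗ Dual.eval ℝ V

theorem contraction_ι_mul (X : V) (α : Dual ℝ V) (y : ExteriorAlgebra ℝ (Dual ℝ V)) :
    contraction X (ι ℝ α * y) = α X • y - ι ℝ α * contraction X y :=
  CliffordAlgebra.contractLeft_ι_mul _ _ _

theorem contraction_ι (X : V) (α : Dual ℝ V) :
    contraction X (ι ℝ α) = algebraMap ℝ _ (α X) :=
  CliffordAlgebra.contractLeft_ι _ _ _

theorem IsContraction.eq_contraction {X : V}
    {c : ExteriorAlgebra ℝ (Dual ℝ V) →ₗ[ℝ] ExteriorAlgebra ℝ (Dual ℝ V)}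
    (h : IsContraction X c) : c = contraction X := by
  have h1 : c 1 = 0 := by
    simpa using h.1 0 1 (by simp [degPart]) 1
  refine LinearMap.ext fun x => ?_
  induction x using CliffordAlgebra.left_induction with
  | algebraMap r =>
    rw [Algebra.algebraMap_eq_smul_one, map_smul, map_smul, h1]
    exact congrArg _ (CliffordAlgebra.contractLeft_one (Q := 0) (Dual.eval ℝ V X)).symm
  | add x y hx hy => rw [map_add, map_add, hx, hy]
  | ι_mul x m hx =>
    refine (h.1 1 _ (ι_mem_degPart m) x).trans ?_
    refine Eq.trans ?_ (contraction_ι_mul X m x).symm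
    erw [h.2 m]
    rw [hx, Algebra.algebraMap_eq_smul_one, smul_one_mul, pow_one, neg_one_smul, ← sub_eq_add_neg]

theorem contraction_mem_degPart (X : V) {k : ℕ} {x : ExteriorAlgebra ℝ (Dual ℝ V)}
    (hx : x ∈ degPart (Dual ℝ V) (k + 1)) : contraction X x ∈ degPart (Dual ℝ V) k := by
  rw [← span_range_ιMulti] at hx
  induction hx using Submodule.span_induction with
  | mem x h =>
    obtain ⟨v, rfl⟩ := h
    induction k with
    | zero =>
      rw [ιMulti_succ_apply, ιMulti_zero_apply, mul_one, contraction_ι, degPart, pow_zero]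
      exact Submodule.algebraMap_mem _
    | succ k ih =>
      rw [ιMulti_succ_apply, contraction_ι_mul]
      refine sub_mem (Submodule.smul_mem _ _ (ιMulti_mem_degPart _)) ?_
      have h := mul_mem_degPart (ι_mem_degPart (v 0)) (ih (Matrix.vecTail v))
      rwa [Nat.add_comm 1 k] at h
  | zero => simp
  | add x y _ _ h₁ h₂ => rw [map_add]; exact add_mem h₁ h₂
  | smul a x _ h => rw [map_smul]; exact Submodule.smul_mem _ _ h

theorem sum_perm_sum {α β A : Type*} [Fintype α] [Fintype β] [DecidableEq α] [DecidableEq β]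
    [AddCommMonoid A] (g : Equiv.Perm (α ⊕ β) → A)
    (hg : ∀ σ, σ ∉ (Equiv.Perm.sumCongrHom α β).range → g σ = 0) :
    ∑ σ, g σ = ∑ p : Equiv.Perm α × Equiv.Perm β, g (p.1.sumCongr p.2) :=
  (Fintype.sum_of_injective (Equiv.Perm.sumCongrHom α β) Equiv.Perm.sumCongrHom_injective _ _ hg
    fun _ => rfl).symm

theorem sum_sign_smul_perm_three (z y : Fin 6 → N) :
    ∑ σ : Equiv.Perm (Fin 3), ((Equiv.Perm.sign σ : ℤ) : ℝ) •
      (ι ℝ (z (Fin.castAdd 3 (σ 0))) * ι ℝ (y (Fin.castAdd 3 (σ 1))) *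
        ι ℝ (y (Fin.castAdd 3 (σ 2)))) =
    (2 : ℝ) • (ι ℝ (z 0) * ι ℝ (y 1) * ι ℝ (y 2) - ι ℝ (z 1) * ι ℝ (y 0) * ι ℝ (y 2) +
      ι ℝ (z 2) * ι ℝ (y 0) * ι ℝ (y 1)) := by
  have h (a b c : N) : ι ℝ a * ι ℝ b * ι ℝ c = -(ι ℝ a * ι ℝ c * ι ℝ b) := by
    rw [mul_assoc, eq_neg_of_add_eq_zero_left (ι_add_mul_swap b c), mul_neg, mul_assoc]
  have h₀ : Equiv.Perm.decomposeFin.symm (0, Equiv.swap 0 1) (2 : Fin 3) = 1 := by decide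
  have h₁ : Equiv.Perm.decomposeFin.symm (1, Equiv.swap 0 1) (2 : Fin 3) = 0 := by decide
  have h₂ : Equiv.Perm.decomposeFin.symm (2, Equiv.swap 0 1) (2 : Fin 3) = 1 := by decide
  simp only [Finset.univ_perm_fin_succ, ← Finset.univ_product_univ, Finset.sum_map,
    Finset.sum_product, Fin.sum_univ_succ]
  simp [Fin.ext_iff, Equiv.swap_apply_def, h₀, h₁, h₂, h _ (y 2), h _ (y 1) (y 0)]
  module

theorem ιMulti_mul_sum_sign_smul_perm (x y z : Fin 6 → N) :
    ιMulti ℝ 3 (fun i => x (Fin.castAdd 3 i)) *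
      ∑ σ : Equiv.Perm (Fin 6), ((Equiv.Perm.sign σ : ℤ) : ℝ) •
        (ι ℝ (z (σ 0)) * ι ℝ (y (σ 1)) * ι ℝ (y (σ 2)) *
          ι ℝ (x (σ 3)) * ι ℝ (x (σ 4)) * ι ℝ (x (σ 5))) =
    (-12 : ℝ) • (ιMulti ℝ 6 x *
      (ι ℝ (z 0) * ι ℝ (y 1) * ι ℝ (y 2) - ι ℝ (z 1) * ι ℝ (y 0) * ι ℝ (y 2) +
        ι ℝ (z 2) * ι ℝ (y 0) * ι ℝ (y 1))) := by
  let u : Fin 3 → N := fun i => x (Fin.castAdd 3 i)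
  let P (σ : Equiv.Perm (Fin 6)) : ExteriorAlgebra ℝ N :=
    ι ℝ (z (σ 0)) * ι ℝ (y (σ 1)) * ι ℝ (y (σ 2))
  let Q (σ : Equiv.Perm (Fin 6)) : Fin 6 → N :=
    (Fin.append u fun i : Fin 3 => x (σ (Fin.natAdd 3 i)) : Fin (3 + 3) → N)
  let e : Fin 3 ⊕ Fin 3 ≃ Fin 6 := finSumFinEquiv
  have he (σ : Equiv.Perm (Fin 3 ⊕ Fin 3)) (s : Fin 3 ⊕ Fin 3) :
      e.permCongr σ (e s) = e (σ s) := by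
    rw [Equiv.permCongr_apply, Equiv.symm_apply_apply]
  have hQl (σ) (i : Fin 3) : Q σ (e (Sum.inl i)) = x (e (Sum.inl i)) := Fin.append_left _ _ _
  have hQr (σ) (i : Fin 3) : Q σ (e (Sum.inr i)) = x (σ (e (Sum.inr i))) :=
    Fin.append_right _ _ _
  have hP (σ) : P σ ∈ degPart N 3 :=
    mul_mem_degPart (mul_mem_degPart (ι_mem_degPart _) (ι_mem_degPart _)) (ι_mem_degPart _)
  have hterm (σ : Equiv.Perm (Fin 6)) : ιMulti ℝ 3 u *
      (ι ℝ (z (σ 0)) * ι ℝ (y (σ 1)) * ι ℝ (y (σ 2)) *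
          ι ℝ (x (σ 3)) * ι ℝ (x (σ 4)) * ι ℝ (x (σ 5))) = -(P σ * ιMulti ℝ 6 (Q σ)) := by
    have h₃ : ι ℝ (z (σ 0)) * ι ℝ (y (σ 1)) * ι ℝ (y (σ 2)) *
          ι ℝ (x (σ 3)) * ι ℝ (x (σ 4)) * ι ℝ (x (σ 5)) =
        P σ * ιMulti ℝ 3 fun i => x (σ (Fin.natAdd 3 i)) := by
      simp only [P, ιMulti_apply, List.ofFn_succ, List.prod_cons, List.ofFn_zero, List.prod_nil,
        mul_one, mul_assoc]
      rfl
    rw [h₃, ← mul_assoc, mul_comm_of_mem_degPart (hP σ) (ιMulti_mem_degPart u),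
      Odd.neg_one_pow (by decide), neg_one_smul, neg_mul, mul_assoc]
    exact congrArg (fun w => -(P σ * w)) (ιMulti_mul_ιMulti _ _)
  have hzero (σ : Equiv.Perm (Fin 3 ⊕ Fin 3))
      (hσ : σ ∉ (Equiv.Perm.sumCongrHom (Fin 3) (Fin 3)).range) :
      ιMulti ℝ 6 (Q (e.permCongr σ)) = 0 := by
    obtain ⟨j, i, hj⟩ : ∃ j i, σ (Sum.inr j) = Sum.inl i := by
      by_contra! hne
      refine hσ (Equiv.Perm.mem_sumCongrHom_range_of_perm_mapsTo_inl ?_)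
      rw [Equiv.Perm.perm_mapsTo_inl_iff_mapsTo_inr]
      rintro _ ⟨j, rfl⟩
      rcases h : σ (Sum.inr j) with i | i
      · exact absurd h (hne j i)
      · exact ⟨i, rfl⟩
    refine (ιMulti ℝ 6).map_eq_zero_of_eq (i := e (Sum.inl i)) (j := e (Sum.inr j)) _ ?_ ?_
    · rw [hQl, hQr, he, hj]
    · simp
  have hblock (ρ₁ ρ₂ : Equiv.Perm (Fin 3)) :
      ιMulti ℝ 6 (Q (e.permCongr (ρ₁.sumCongr ρ₂))) =
        ((Equiv.Perm.sign ρ₂ : ℤ) : ℝ) • ιMulti ℝ 6 x := by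
    have : Q (e.permCongr (ρ₁.sumCongr ρ₂)) =
        x ∘ e.permCongr (Equiv.sumCongr 1 ρ₂) := by
      funext i
      obtain ⟨i | i, rfl⟩ := e.surjective i
      · rw [hQl, Function.comp_apply, he, Equiv.sumCongr_apply, Sum.map_inl, Equiv.Perm.one_apply]
      · rw [hQr, Function.comp_apply, he, he, Equiv.sumCongr_apply, Equiv.Perm.sumCongr_apply,
          Sum.map_inr, Sum.map_inr]
    rw [this, AlternatingMap.map_perm, Equiv.Perm.sign_permCongr]
    erw [Equiv.Perm.sign_sumCongr]
    simp [Units.smul_def, ← Int.cast_smul_eq_zsmul ℝ]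
  calc _ = -∑ σ : Equiv.Perm (Fin 6), ((Equiv.Perm.sign σ : ℤ) : ℝ) •
        (P σ * ιMulti ℝ 6 (Q σ)) := by
        rw [Finset.mul_sum, ← Finset.sum_neg_distrib]
        refine Finset.sum_congr rfl fun σ _ => ?_
        rw [mul_smul_comm, hterm, smul_neg]
    _ = -∑ p : Equiv.Perm (Fin 3) × Equiv.Perm (Fin 3),
        ((Equiv.Perm.sign p.1 : ℤ) : ℝ) •
          (P (e.permCongr (p.1.sumCongr p.2)) * ιMulti ℝ 6 x) := by
        rw [← Equiv.sum_comp (e.permCongr : Equiv.Perm (Fin 3 ⊕ Fin 3) ≃ _), sum_perm_sum]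
        · refine congrArg _ (Finset.sum_congr rfl fun p _ => ?_)
          rw [hblock, mul_smul_comm, smul_smul, Equiv.Perm.sign_permCongr,
            Equiv.Perm.sign_sumCongr]
          rcases Int.units_eq_one_or (Equiv.Perm.sign p.2) with h | h <;> simp [h]
        · intro σ hσ
          rw [hzero σ hσ, mul_zero, smul_zero]
    _ = -((6 : ℝ) • ((∑ ρ : Equiv.Perm (Fin 3), ((Equiv.Perm.sign ρ : ℤ) : ℝ) •
      (ι ℝ (z (Fin.castAdd 3 (ρ 0))) * ι ℝ (y (Fin.castAdd 3 (ρ 1))) *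
        ι ℝ (y (Fin.castAdd 3 (ρ 2))))) * ιMulti ℝ 6 x)) := by
        rw [Fintype.sum_prod_type, Finset.sum_mul, Finset.smul_sum]
        refine congrArg _ (Finset.sum_congr rfl fun ρ _ => ?_)
        have h₆ (ρ' : Equiv.Perm (Fin 3)) : P (e.permCongr (ρ.sumCongr ρ')) =
            ι ℝ (z (Fin.castAdd 3 (ρ 0))) * ι ℝ (y (Fin.castAdd 3 (ρ 1))) *
              ι ℝ (y (Fin.castAdd 3 (ρ 2))) := rfl
        simp only [h₆, Finset.sum_const, Finset.card_univ, Fintype.card_perm, Fintype.card_fin,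
          smul_mul_assoc]
        rw [← Nat.cast_smul_eq_nsmul ℝ]
        norm_num [Nat.factorial]
    _ = _ := by
        have h₃ (a b c : N) : ι ℝ a * ι ℝ b * ι ℝ c ∈ degPart N 3 :=
          mul_mem_degPart (mul_mem_degPart (ι_mem_degPart a) (ι_mem_degPart b)) (ι_mem_degPart c)
        rw [sum_sign_smul_perm_three, smul_mul_assoc, mul_comm_of_mem_degPart
          (ιMulti_mem_degPart x) (add_mem (sub_mem (h₃ _ _ _) (h₃ _ _ _)) (h₃ _ _ _)),
          Even.neg_one_pow (by decide)]
        module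

theorem contraction_ιMulti_three (X : V) (v : Fin 3 → Dual ℝ V) :
    contraction X (ιMulti ℝ 3 v) =
      v 0 X • (ι ℝ (v 1) * ι ℝ (v 2)) - v 1 X • (ι ℝ (v 0) * ι ℝ (v 2)) +
        v 2 X • (ι ℝ (v 0) * ι ℝ (v 1)) := by
  have h : ιMulti ℝ 3 v = ι ℝ (v 0) * (ι ℝ (v 1) * ι ℝ (v 2)) := by
    simp only [ιMulti_apply, List.ofFn_succ, List.prod_cons, List.ofFn_zero, List.prod_nil, mul_one]
    rfl
  rw [h, contraction_ι_mul, contraction_ι_mul, contraction_ι, Algebra.algebraMap_eq_smul_one,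
    mul_sub, mul_smul_comm, mul_smul_comm, mul_smul_comm, mul_one]
  module

theorem copyMap_ι (m : ℕ) (x : Fin m) (α : Dual ℝ V) :
    copyMap m x (ι ℝ α) =
      ι ℝ ((LinearMap.proj x : (Fin m → V) →ₗ[ℝ] V).dualMap α) :=
  map_apply_ι _ _

theorem copyVol_eq_copyMap (m : ℕ) (b : Basis (Fin 6) ℝ V) (x : Fin m) :
    copyVol m b x = copyMap m x (volForm b) := by
  rw [copyVol, volForm, map_list_prod, List.map_ofFn]
  exact congrArg (fun f => (List.ofFn f).prod) (funext fun j => (copyMap_ι m x _).symm)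

/-- Wedging a 3-form with `C_{zyx}` in the copy `x` replaces it by its volume form and polarizes
the 3-form in the remaining copies `z` and `y`. -/
theorem copyMap_mul_shuffleForm (m : ℕ) (b : Basis (Fin 6) ℝ V) (x y z : Fin m)
    {τ : ExteriorAlgebra ℝ (Dual ℝ V)} (hτ : τ ∈ degPart (Dual ℝ V) 3) :
    copyMap m x τ * shuffleForm m b z y x =
      -(copyVol m b x * ∑ i, copyForm m b z i * copyMap m y (contraction (b i) τ)) := by
  let L : ExteriorAlgebra ℝ (Dual ℝ V) →ₗ[ℝ] ExteriorAlgebra ℝ (Dual ℝ (Fin m → V)) :=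
    LinearMap.mulRight ℝ (shuffleForm m b z y x) ∘ₗ (copyMap m x).toLinearMap
  let R : ExteriorAlgebra ℝ (Dual ℝ V) →ₗ[ℝ] ExteriorAlgebra ℝ (Dual ℝ (Fin m → V)) :=
    -(LinearMap.mulLeft ℝ (copyVol m b x) ∘ₗ ∑ i, LinearMap.mulLeft ℝ (copyForm m b z i) ∘ₗ
      (copyMap m y).toLinearMap ∘ₗ contraction (b i))
  have hR (t) : R t =
      -(copyVol m b x * ∑ i, copyForm m b z i * copyMap m y (contraction (b i) t)) := by
    simp [R, Finset.mul_sum]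
  suffices h : L.compAlternatingMap (ιMulti ℝ 3) = R.compAlternatingMap (ιMulti ℝ 3) by
    refine Eq.trans ?_ (hR τ)
    change L τ = R τ
    rw [← span_range_ιMulti] at hτ
    refine LinearMap.eqOn_span (f := L) (g := R) ?_ hτ
    rintro _ ⟨v, rfl⟩
    exact DFunLike.congr_fun h v
  refine b.dualBasis.ext_alternating fun v hv => ?_
  obtain ⟨π, hπ⟩ := (Equiv.Perm.isMultiplyPretransitive (Fin 6) 3).exists_smul_eq
    (Fin.castAddEmb 3 : Fin 3 ↪ Fin 6) ⟨v, hv⟩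
  have hπ (i : Fin 3) : π (Fin.castAdd 3 i) = v i := DFunLike.congr_fun hπ i
  let w (x : Fin m) (j : Fin 6) : Dual ℝ (Fin m → V) :=
    (LinearMap.proj x : (Fin m → V) →ₗ[ℝ] V).dualMap (b.dualBasis j)
  have hvol : ιMulti ℝ 6 (w x ∘ π) = ((Equiv.Perm.sign π : ℤ) : ℝ) • copyVol m b x := by
    have h : ιMulti ℝ 6 (w x) = copyVol m b x := rfl
    rw [AlternatingMap.map_perm, h, Units.smul_def, Int.cast_smul_eq_zsmul]
  have hsq : ((Equiv.Perm.sign π : ℤ) : ℝ) * ((Equiv.Perm.sign π : ℤ) : ℝ) = 1 := by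
    rcases Int.units_eq_one_or (Equiv.Perm.sign π) with h | h <;> simp [h]
  have hshuffle : shuffleForm m b z y x = ((12⁻¹ : ℝ) * ((Equiv.Perm.sign π : ℤ) : ℝ)) •
      ∑ σ : Equiv.Perm (Fin 6), ((Equiv.Perm.sign σ : ℤ) : ℝ) •
        (ι ℝ ((w z ∘ π) (σ 0)) * ι ℝ ((w y ∘ π) (σ 1)) * ι ℝ ((w y ∘ π) (σ 2)) *
          ι ℝ ((w x ∘ π) (σ 3)) * ι ℝ ((w x ∘ π) (σ 4)) * ι ℝ ((w x ∘ π) (σ 5))) := by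
    rw [shuffleForm, ← Equiv.sum_comp (Equiv.mulLeft π), mul_smul,
      Finset.smul_sum (r := ((Equiv.Perm.sign π : ℤ) : ℝ))]
    refine congrArg _ (Finset.sum_congr rfl fun σ _ => ?_)
    rw [smul_smul, Equiv.coe_mulLeft, Equiv.Perm.sign_mul, Units.val_mul, Int.cast_mul]
    rfl
  have hleft : copyMap m x (ιMulti ℝ 3 fun i => b.dualBasis (v i)) =
      ιMulti ℝ 3 fun i => (w x ∘ π) (Fin.castAdd 3 i) := by
    rw [copyMap, map_apply_ιMulti]
    exact congrArg _ (funext fun i => by simp only [Function.comp_apply, hπ, w])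
  have hpol : ∑ i, copyForm m b z i *
        copyMap m y (contraction (b i) (ιMulti ℝ 3 fun i => b.dualBasis (v i))) =
      ι ℝ ((w z ∘ π) 0) * ι ℝ ((w y ∘ π) 1) * ι ℝ ((w y ∘ π) 2) -
        ι ℝ ((w z ∘ π) 1) * ι ℝ ((w y ∘ π) 0) * ι ℝ ((w y ∘ π) 2) +
        ι ℝ ((w z ∘ π) 2) * ι ℝ ((w y ∘ π) 0) * ι ℝ ((w y ∘ π) 1) := by
    have h₀ : π 0 = v 0 := hπ 0
    have h₁ : π 1 = v 1 := hπ 1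
    have h₂ : π 2 = v 2 := hπ 2
    have hd (i j : Fin 6) : b.dualBasis i (b j) = if i = j then 1 else 0 := by
      simp [Finsupp.single_apply, eq_comm]
    simp only [contraction_ιMulti_three, map_add, map_sub, map_smul, map_mul, mul_add, mul_sub,
      mul_smul_comm, Finset.sum_add_distrib, Finset.sum_sub_distrib]
    simp only [hd, ite_smul, one_smul, zero_smul, Finset.sum_ite_eq, Finset.mem_univ, if_true,
      Function.comp_apply, h₀, h₁, h₂, copyMap_ι, mul_assoc, w, copyForm]
  refine Eq.trans ?_ (hR (ιMulti ℝ 3 fun i => b.dualBasis (v i))).symm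
  change copyMap m x (ιMulti ℝ 3 fun i => b.dualBasis (v i)) * shuffleForm m b z y x = _
  rw [hpol, hleft, hshuffle, mul_smul_comm, ιMulti_mul_sum_sign_smul_perm, hvol, smul_mul_assoc,
    smul_smul, smul_smul]
  rw [show (12⁻¹ : ℝ) * ((Equiv.Perm.sign π : ℤ) : ℝ) * -12 * ((Equiv.Perm.sign π : ℤ) : ℝ) = -1
    by linear_combination -hsq, neg_one_smul]

theorem copyMap_mem_degPart (m : ℕ) (x : Fin m) {k : ℕ} {t : ExteriorAlgebra ℝ (Dual ℝ V)}
    (ht : t ∈ degPart (Dual ℝ V) k) : copyMap m x t ∈ degPart (Dual ℝ (Fin m → V)) k :=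
  map_mem_degPart _ ht

theorem volForm_mem_degPart (b : Basis (Fin 6) ℝ V) : volForm b ∈ degPart (Dual ℝ V) 6 :=
  ιMulti_mem_degPart b.dualBasis

theorem ι_dualBasis_mul_contraction_volForm (b : Basis (Fin 6) ℝ V) (j : Fin 6) (X : V) :
    ι ℝ (b.dualBasis j) * contraction X (volForm b) = b.repr X j • volForm b := by
  have h : ι ℝ (b.dualBasis j) * volForm b = 0 := ι_mul_prod_list b.dualBasis j
  have h' := contraction_ι_mul X (b.dualBasis j) (volForm b)
  rw [h, map_zero, eq_comm, sub_eq_zero] at h'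
  rw [← h', Basis.dualBasis_apply]

end PolarizedVolume

/-- Proposition `prop:Cefgh`.  With copies `e = 0`, `f = 1`, `g = 2`, `h = 3`
of the 6-dimensional space `V`, for any 3-form `τ` one has
`τ_e ∧ C_{gfe} ∧ τ_f ∧ τ_h ∧ C_{fgh} ∧ τ_g = -6 λ(τ) vol_{efgh}`,
where `λ(τ) = (1/6) tr(K_τ²)` is the scalar Hitchin invariant, `K_τ : V → V` being determined by
`ι_{K_τ x} vol = ι_x τ ∧ τ`. -/
theorem prop_Cefgh (b : Basis (Fin 6) ℝ V)
    (τ : ExteriorAlgebra ℝ (Dual ℝ V)) (hτ : τ ∈ degPart (Dual ℝ V) 3)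
    (C : V → (ExteriorAlgebra ℝ (Dual ℝ V) →ₗ[ℝ] ExteriorAlgebra ℝ (Dual ℝ V)))
    (hC : ∀ x : V, IsContraction x (C x))
    (K : V →ₗ[ℝ] V)
    (hK : ∀ x : V, C (K x) (volForm b) = C x τ * τ) :
    copyMap 4 0 τ * shuffleForm 4 b 2 1 0 * copyMap 4 1 τ * copyMap 4 3 τ *
        shuffleForm 4 b 1 2 3 * copyMap 4 2 τ =
      (-(6 : ℝ) * ((6⁻¹ : ℝ) * LinearMap.trace ℝ V (K ∘ₗ K))) •
        (copyVol 4 b 0 * copyVol 4 b 1 * copyVol 4 b 2 * copyVol 4 b 3) := by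
  have hC' (x : V) : C x = contraction x := (hC x).eq_contraction
  have hK' (x : V) : contraction x τ * τ = contraction (K x) (volForm b) := by
    rw [← hC', ← hK, hC']
  have hpol (x y z : Fin 4) : copyMap 4 x τ * shuffleForm 4 b z y x * copyMap 4 y τ =
      -(copyVol 4 b x * ∑ i, copyForm 4 b z i *
        copyMap 4 y (contraction (K (b i)) (volForm b))) := by
    rw [copyMap_mul_shuffleForm 4 b x y z hτ, neg_mul, mul_assoc, Finset.sum_mul]
    simp only [mul_assoc, ← map_mul, hK']
  have hform (x : Fin 4) (i : Fin 6) : copyForm 4 b x i = copyMap 4 x (ι ℝ (b.dualBasis i)) :=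
    (copyMap_ι 4 x _).symm
  have hι (x : Fin 4) (i : Fin 6) : copyForm 4 b x i ∈ degPart _ 1 := ι_mem_degPart _
  have hvol (x : Fin 4) : copyVol 4 b x ∈ degPart _ 6 :=
    copyVol_eq_copyMap 4 b x ▸ copyMap_mem_degPart 4 x (volForm_mem_degPart b)
  have hcomm (x : Fin 4) {k : ℕ} {t} (ht : t ∈ degPart (Dual ℝ (Fin 4 → V)) k) :
      t * copyVol 4 b x = copyVol 4 b x * t := by
    rw [mul_comm_of_mem_degPart (hvol x) ht, Even.neg_one_pow ((by decide : Even 6).mul_right k),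
      one_smul]
  have hW (x : Fin 4) (X : V) : copyMap 4 x (contraction X (volForm b)) ∈ degPart _ 5 :=
    copyMap_mem_degPart 4 x (contraction_mem_degPart X (volForm_mem_degPart b))
  have hιW (x : Fin 4) (j : Fin 6) (X : V) :
      copyForm 4 b x j * copyMap 4 x (contraction X (volForm b)) = b.repr X j • copyVol 4 b x := by
    rw [hform, ← map_mul, ι_dualBasis_mul_contraction_volForm, map_smul, copyVol_eq_copyMap]
  have hterm (i j : Fin 6) :
      copyVol 4 b 0 * (copyForm 4 b 2 i * copyMap 4 1 (contraction (K (b i)) (volForm b))) *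
        (copyVol 4 b 3 * (copyForm 4 b 1 j * copyMap 4 2 (contraction (K (b j)) (volForm b)))) =
      -(b.repr (K (b i)) j * b.repr (K (b j)) i) •
        (copyVol 4 b 0 * copyVol 4 b 1 * copyVol 4 b 2 * copyVol 4 b 3) := by
    set F := copyMap 4 1 (contraction (K (b i)) (volForm b)) with hF
    set G := copyMap 4 2 (contraction (K (b j)) (volForm b))
    have hFf : F * copyForm 4 b 1 j = -(b.repr (K (b i)) j • copyVol 4 b 1) := by
      rw [mul_comm_of_mem_degPart (hι 1 j) (hW 1 _), hιW, Odd.neg_one_pow (by decide), neg_one_smul]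
    calc _ = copyVol 4 b 0 * (copyForm 4 b 2 i * F * copyVol 4 b 3) * copyForm 4 b 1 j * G := by
          simp only [mul_assoc]
      _ = copyVol 4 b 0 * copyVol 4 b 3 * (copyForm 4 b 2 i * (F * copyForm 4 b 1 j)) * G := by
          rw [hcomm 3 (mul_mem_degPart (hι 2 i) (hW 1 (K (b i)))), ← hF]
          simp only [mul_assoc]
      _ = -(b.repr (K (b i)) j • (copyVol 4 b 0 * copyVol 4 b 3 * (copyVol 4 b 1 *
            (copyForm 4 b 2 i * G)))) := by
          rw [hFf, mul_neg, mul_smul_comm, hcomm 1 (hι 2 i)]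
          simp only [mul_neg, neg_mul, mul_smul_comm, smul_mul_assoc, mul_assoc]
      _ = _ := by
          rw [hιW, mul_smul_comm, mul_smul_comm, smul_smul, neg_smul, mul_assoc _ (copyVol 4 b 3),
            ← hcomm 3 (mul_mem_degPart (hvol 1) (hvol 2))]
          simp only [mul_assoc]
  have htrace : LinearMap.trace ℝ V (K ∘ₗ K) =
      ∑ i, ∑ j, b.repr (K (b i)) j * b.repr (K (b j)) i := by
    rw [LinearMap.trace_eq_matrix_trace ℝ b, LinearMap.toMatrix_comp b b b, Matrix.trace]
    simp only [Matrix.diag_apply, Matrix.mul_apply, LinearMap.toMatrix_apply]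
    exact Finset.sum_congr rfl fun i _ => Finset.sum_congr rfl fun j _ => mul_comm _ _
  calc _ = (copyMap 4 0 τ * shuffleForm 4 b 2 1 0 * copyMap 4 1 τ) *
        (copyMap 4 3 τ * shuffleForm 4 b 1 2 3 * copyMap 4 2 τ) := by simp only [mul_assoc]
    _ = _ := by
      rw [hpol, hpol, neg_mul_neg, Finset.mul_sum, Finset.mul_sum, Finset.sum_mul_sum]
      simp only [hterm]
      simp only [← Finset.sum_smul, Finset.sum_neg_distrib, ← htrace]
      rw [neg_mul, mul_inv_cancel_left₀ (by norm_num)]
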